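/- For all positive real numbers α and β, F̃(α,β) = (Γ(α)Γ(β)/Γ(α+β))²·₃F₂(α, β, α+β−1; α+β, α+β; 1), where the ₃F₂ series on the right-hand side converges. -/

import Mathlib

/-- Pochhammer symbol (α, n) = α(α+1)⋯(α+n-1). -/
noncomputable def poch (α : ℝ) (n : ℕ) : ℝ := ∏ i ∈ Finset.range n, (α + i)

/-- F̃(α,β) = (Γ(α)Γ(β)/Γ(α+β+1)) · Σ_{m,n≥0} (α,m)(β,n)/(α+β+1, m+n). -/
noncomputable def Ftilde (α β : ℝ) : ℝ :=
  (Real.Gamma α * Real.Gamma β / Real.Gamma (α + β + 1)) *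
    ∑' p : ℕ × ℕ, poch α p.1 * poch β p.2 / poch (α + β + 1) (p.1 + p.2)

open Filter Topology

theorem poch_zero (a : ℝ) : poch a 0 = 1 := by simp [poch]

theorem poch_succ (a : ℝ) (n : ℕ) : poch a (n + 1) = poch a n * (a + n) := by
  simp [poch, Finset.prod_range_succ]

theorem poch_pos {a : ℝ} (ha : 0 < a) (n : ℕ) : 0 < poch a n :=
  Finset.prod_pos fun _ _ => by positivity

theorem mul_poch_add_one (a : ℝ) (n : ℕ) : a * poch (a + 1) n = poch a n * (a + n) := by
  induction n with
  | zero => simp [poch_zero]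
  | succ n ih =>
    rw [poch_succ, poch_succ, ← mul_assoc, ih]
    push_cast
    ring

theorem poch_add (a : ℝ) (m n : ℕ) : poch a (m + n) = poch a m * poch (a + m) n := by
  induction n with
  | zero => simp [poch_zero]
  | succ n ih =>
    rw [← add_assoc, poch_succ, poch_succ, ih]
    push_cast
    ring

theorem tendsto_rpow_mul_poch_div {a b : ℝ} (ha : 0 < a) (hb : 0 < b) :
    Tendsto (fun n : ℕ => (n : ℝ) ^ (b - a) * (poch a (n + 1) / poch b (n + 1))) atTop
      (𝓝 (Real.Gamma b / Real.Gamma a)) := by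
  refine ((Real.GammaSeq_tendsto_Gamma b).div (Real.GammaSeq_tendsto_Gamma a)
    (Real.Gamma_pos_of_pos ha).ne').congr' ?_
  filter_upwards [eventually_gt_atTop 0] with n hn
  have hn' : (0 : ℝ) < n := by exact_mod_cast hn
  have h1 := (poch_pos ha (n + 1)).ne'
  have h2 := (poch_pos hb (n + 1)).ne'
  have h3 : (n.factorial : ℝ) ≠ 0 := by exact_mod_cast n.factorial_ne_zero
  have h4 := (Real.rpow_pos_of_pos hn' a).ne'
  simp only [Pi.div_apply]
  change (n : ℝ) ^ b * n.factorial / poch b (n + 1) / ((n : ℝ) ^ a * n.factorial / poch a (n + 1))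
    = _
  rw [Real.rpow_sub hn']
  field_simp

theorem tendsto_poch_div {a b : ℝ} (ha : 0 < a) (hab : a < b) :
    Tendsto (fun n : ℕ => poch a n / poch b n) atTop (𝓝 0) := by
  rw [← tendsto_add_atTop_iff_nat 1]
  have h1 := tendsto_rpow_mul_poch_div ha (ha.trans hab)
  have h2 : Tendsto (fun n : ℕ => (n : ℝ) ^ (-(b - a))) atTop (𝓝 0) :=
    (tendsto_rpow_neg_atTop (sub_pos.2 hab)).comp tendsto_natCast_atTop_atTop
  have h3 := h2.mul h1
  rw [zero_mul] at h3
  refine h3.congr' ?_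
  filter_upwards [eventually_gt_atTop 0] with n hn
  have hn' : (0 : ℝ) < n := by exact_mod_cast hn
  rw [← mul_assoc, ← Real.rpow_add hn', neg_add_cancel, Real.rpow_zero, one_mul]

theorem hasSum_poch_div {a c : ℝ} (ha : 0 < a) (hac : a < c) :
    HasSum (fun n : ℕ => poch a n / poch (c + 1) n) (c / (c - a)) := by
  have hc : 0 < c := ha.trans hac
  have hca : c - a ≠ 0 := (sub_pos.2 hac).ne'
  rw [hasSum_iff_tendsto_nat_of_nonneg
    fun n => (div_pos (poch_pos ha n) (poch_pos (by linarith) n)).le]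
  have key : ∀ N : ℕ, ∑ n ∈ Finset.range N, poch a n / poch (c + 1) n =
      c / (c - a) - c / (c - a) * (poch a N / poch c N) := by
    intro N
    induction N with
    | zero => simp [poch_zero]
    | succ N ih =>
      have h1 := (poch_pos hc N).ne'
      have h2 : c + N ≠ 0 := by positivity
      have h3 : poch (c + 1) N = poch c N * (c + N) / c := by
        rw [← mul_poch_add_one]
        field_simp
      rw [Finset.sum_range_succ, ih, h3, poch_succ, poch_succ]
      field_simp
      ring
  simp_rw [key]
  simpa using ((tendsto_poch_div ha hac).const_mul (c / (c - a))).const_sub (c / (c - a))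

/-- The Euler beta function in terms of the Gamma function. -/
noncomputable def betaFn (α β : ℝ) : ℝ :=
  Real.Gamma α * Real.Gamma β / Real.Gamma (α + β)

theorem betaFn_pos {α β : ℝ} (hα : 0 < α) (hβ : 0 < β) : 0 < betaFn α β :=
  div_pos (mul_pos (Real.Gamma_pos_of_pos hα) (Real.Gamma_pos_of_pos hβ))
    (Real.Gamma_pos_of_pos (add_pos hα hβ))

theorem betaFn_comm (α β : ℝ) : betaFn α β = betaFn β α := by
  rw [betaFn, betaFn, mul_comm, add_comm]

theorem betaFn_add_one {α β : ℝ} (hα : 0 < α) (hβ : 0 < β) :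
    betaFn α (β + 1) = betaFn α β * (β / (α + β)) := by
  have h : α + β ≠ 0 := by positivity
  have h' := (Real.Gamma_pos_of_pos (add_pos hα hβ)).ne'
  rw [betaFn, betaFn, ← add_assoc, Real.Gamma_add_one hβ.ne', Real.Gamma_add_one h]
  field_simp

theorem betaFn_add_nat {α β : ℝ} (hα : 0 < α) (hβ : 0 < β) (n : ℕ) :
    betaFn α (β + n) = betaFn α β * (poch β n / poch (α + β) n) := by
  induction n with
  | zero => simp [poch_zero]
  | succ n ih =>
    have h := (poch_pos (add_pos hα hβ) n).ne'
    push_cast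
    rw [← add_assoc, betaFn_add_one hα (by positivity), ih, poch_succ, poch_succ, ← add_assoc]
    field_simp

theorem tendsto_betaFn_add_nat {α β : ℝ} (hα : 0 < α) (hβ : 0 < β) :
    Tendsto (fun n : ℕ => betaFn α (β + n)) atTop (𝓝 0) := by
  simp_rw [betaFn_add_nat hα hβ]
  simpa using (tendsto_poch_div hβ (by linarith : β < α + β)).const_mul (betaFn α β)

/-- The terms of `₃F₂(α, β, α+β-1; α+β, α+β; 1)`. -/
noncomputable def hyperTerm (α β : ℝ) (n : ℕ) : ℝ :=
  poch α n * poch β n * poch (α + β - 1) n / (poch (α + β) n * poch (α + β) n * poch 1 n)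

theorem hyperTerm_comm (α β : ℝ) (n : ℕ) : hyperTerm α β n = hyperTerm β α n := by
  rw [hyperTerm, hyperTerm, add_comm α β, mul_comm (poch α n)]

/-- The terms of `₂F₁(α, β; α+β; 1)`. -/
noncomputable def gaussTerm (α β : ℝ) (n : ℕ) : ℝ :=
  poch α n * poch β n / (poch (α + β) n * poch 1 n)

theorem gaussTerm_pos {α β : ℝ} (hα : 0 < α) (hβ : 0 < β) (n : ℕ) : 0 < gaussTerm α β n :=
  div_pos (mul_pos (poch_pos hα n) (poch_pos hβ n))
    (mul_pos (poch_pos (add_pos hα hβ) n) (poch_pos one_pos n))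

theorem gaussTerm_succ {α β : ℝ} (hα : 0 < α) (hβ : 0 < β) (n : ℕ) :
    gaussTerm α β (n + 1) =
      gaussTerm α β n * ((α + n) * (β + n) / ((α + β + n) * (n + 1))) := by
  have h1 := (poch_pos (add_pos hα hβ) n).ne'
  have h2 := (poch_pos one_pos n).ne'
  simp only [gaussTerm, poch_succ]
  field_simp
  ring

theorem hyperTerm_mul {α β : ℝ} (hα : 0 < α) (hβ : 0 < β) (n : ℕ) :
    hyperTerm α β n * (α + β - 1 + n) = gaussTerm α β n * (α + β - 1) := by
  have h1 := (poch_pos (add_pos hα hβ) n).ne'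
  have h2 := (poch_pos one_pos n).ne'
  have h3 := mul_poch_add_one (α + β - 1) n
  rw [sub_add_cancel] at h3
  simp only [hyperTerm, gaussTerm]
  field_simp
  linear_combination -(poch α n * poch β n) * h3

theorem hyperTerm_add_one {α β : ℝ} (hα : 0 < α) (hβ : 0 < β) (n : ℕ) :
    hyperTerm α (β + 1) n =
      gaussTerm α β n * ((α + β) ^ 2 * (β + n) / (β * (α + β + n) ^ 2)) := by
  have h1 := (poch_pos (add_pos hα hβ) n).ne'
  have h2 := (poch_pos one_pos n).ne'
  have hs : α + β ≠ 0 := by positivity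
  have h3 : poch (β + 1) n = poch β n * (β + n) / β := by
    rw [← mul_poch_add_one]
    field_simp
  have h4 : poch (α + β + 1) n = poch (α + β) n * (α + β + n) / (α + β) := by
    rw [← mul_poch_add_one]
    field_simp
  have h5 : α + β + n ≠ 0 := by positivity
  rw [hyperTerm, gaussTerm, ← add_assoc, add_sub_cancel_right, h3, h4]
  field_simp

theorem tendsto_mul_gaussTerm {α β : ℝ} (hα : 0 < α) (hβ : 0 < β) :
    Tendsto (fun n : ℕ => (n : ℝ) * gaussTerm α β (n + 1)) atTop (𝓝 (betaFn α β)⁻¹) := by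
  have h := (tendsto_rpow_mul_poch_div hα (add_pos hα hβ)).mul
    (tendsto_rpow_mul_poch_div hβ one_pos)
  have e : Real.Gamma (α + β) / Real.Gamma α * (Real.Gamma 1 / Real.Gamma β) =
      (betaFn α β)⁻¹ := by
    rw [betaFn, Real.Gamma_one, inv_div, div_mul_div_comm, mul_one]
  rw [e] at h
  refine h.congr' ?_
  filter_upwards [eventually_gt_atTop 0] with n hn
  have hn' : (0 : ℝ) < n := by exact_mod_cast hn
  rw [mul_mul_mul_comm, ← Real.rpow_add hn', div_mul_div_comm, gaussTerm]
  congr 1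
  rw [show α + β - α + (1 - β) = 1 by ring, Real.rpow_one]

theorem summable_hyperTerm {α β : ℝ} (hα : 0 < α) (hβ : 0 < β) :
    Summable (hyperTerm α β) := by
  rw [← summable_nat_add_iff 1]
  obtain ⟨C, hC⟩ := (tendsto_mul_gaussTerm hα hβ).bddAbove_range
  have hsum : Summable fun n : ℕ => C * |α + β - 1| * (1 / (n : ℝ) ^ 2) :=
    (Real.summable_one_div_nat_pow.2 one_lt_two).mul_left _
  refine hsum.of_norm_bounded_eventually_nat ?_
  filter_upwards [eventually_gt_atTop 0] with n hn
  have hn' : (0 : ℝ) < n := by exact_mod_cast hn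
  have hq := hC ⟨n, rfl⟩
  simp only at hq
  have hpos := gaussTerm_pos hα hβ (n + 1)
  have h := hyperTerm_mul hα hβ (n + 1)
  push_cast at h
  have hd : 0 < α + β + n := by positivity
  have e : hyperTerm α β (n + 1) = gaussTerm α β (n + 1) * (α + β - 1) / (α + β + n) := by
    rw [eq_div_iff hd.ne', ← h]
    ring
  rw [e, Real.norm_eq_abs, abs_div, abs_mul, abs_of_pos hpos, abs_of_pos hd]
  calc gaussTerm α β (n + 1) * |α + β - 1| / (α + β + n)
      ≤ gaussTerm α β (n + 1) * |α + β - 1| / n := by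
        gcongr
        linarith
    _ = n * gaussTerm α β (n + 1) * |α + β - 1| * (1 / (n : ℝ) ^ 2) := by
        field_simp
    _ ≤ _ := by gcongr

/-- The value of the hypergeometric side. -/
noncomputable def hyperValue (α β : ℝ) : ℝ := betaFn α β ^ 2 * ∑' n, hyperTerm α β n

theorem hyperValue_comm (α β : ℝ) : hyperValue α β = hyperValue β α := by
  simp only [hyperValue, betaFn_comm α β, hyperTerm_comm α β]

/-- A Wilf–Zeilberger mate of `betaFn α β ^ 2 * hyperTerm α β n` for the shift of `β`. -/
noncomputable def hyperMate (α β : ℝ) (n : ℕ) : ℝ :=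
  betaFn α β ^ 2 * (gaussTerm α β n * (n * (n + α + β - 1 + β) / (β * (α + β + n - 1))))

theorem hyperMate_succ_sub {α β : ℝ} (hα : 0 < α) (hβ : 0 < β) (n : ℕ) :
    betaFn α β ^ 2 * hyperTerm α β n - betaFn α (β + 1) ^ 2 * hyperTerm α (β + 1) n =
      hyperMate α β (n + 1) - hyperMate α β n := by
  have hs : α + β ≠ 0 := by positivity
  have hsn : α + β + n ≠ 0 := by positivity
  rw [hyperTerm_add_one hα hβ, betaFn_add_one hα hβ, hyperMate, hyperMate, gaussTerm_succ hα hβ]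
  rcases n with _ | n
  · simp [hyperTerm, gaussTerm, poch_zero]
    field_simp
    ring
  · have hd : α + β + n ≠ 0 := by positivity
    have h := hyperTerm_mul hα hβ (n + 1)
    push_cast at h hsn ⊢
    have e : hyperTerm α β (n + 1) = gaussTerm α β (n + 1) * (α + β - 1) / (α + β + n) := by
      rw [eq_div_iff hd, ← h]
      ring
    rw [e, show α + β + (n + 1 : ℝ) - 1 = α + β + n by ring,
      show α + β + (n + 1 + 1 : ℝ) - 1 = α + β + (n + 1) by ring]
    field_simp
    ring

theorem tendsto_hyperMate {α β : ℝ} (hα : 0 < α) (hβ : 0 < β) :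
    Tendsto (hyperMate α β) atTop (𝓝 (betaFn α β / β)) := by
  rw [← tendsto_add_atTop_iff_nat 1]
  have hinv : Tendsto (fun n : ℕ => (1 : ℝ) / n) atTop (𝓝 0) := tendsto_one_div_atTop_nhds_zero_nat
  have h2 : Tendsto (fun n : ℕ => (1 + 1 * (1 / (n : ℝ))) * (1 + (α + β + β) * (1 / (n : ℝ))) /
      (β * (1 + (α + β) * (1 / (n : ℝ))))) atTop (𝓝 ((1 + 1 * 0) * (1 + (α + β + β) * 0) /
      (β * (1 + (α + β) * 0)))) := by
    refine Tendsto.div (((hinv.const_mul _).const_add _).mul ((hinv.const_mul _).const_add _))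
      (((hinv.const_mul _).const_add _).const_mul _) ?_
    simpa using hβ.ne'
  have h3 := ((tendsto_mul_gaussTerm hα hβ).mul h2).const_mul (betaFn α β ^ 2)
  have hb := (betaFn_pos hα hβ).ne'
  have e : betaFn α β ^ 2 * ((betaFn α β)⁻¹ * ((1 + 1 * 0) * (1 + (α + β + β) * 0) /
      (β * (1 + (α + β) * 0)))) = betaFn α β / β := by
    field_simp
    ring
  rw [e] at h3
  refine h3.congr' ?_
  filter_upwards [eventually_gt_atTop 0] with n hn
  have hn' : (0 : ℝ) < n := by exact_mod_cast hn
  have hd : α + β + n ≠ 0 := by positivity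
  rw [hyperMate]
  push_cast
  rw [show α + β + (n + 1 : ℝ) - 1 = α + β + n by ring]
  have hd' : (n : ℝ) + (α + β) ≠ 0 := by positivity
  field_simp
  ring

theorem hyperValue_sub {α β : ℝ} (hα : 0 < α) (hβ : 0 < β) :
    hyperValue α β - hyperValue α (β + 1) = betaFn α β / β := by
  have h := (((summable_hyperTerm hα hβ).hasSum.mul_left (betaFn α β ^ 2)).sub
    ((summable_hyperTerm hα (by linarith : 0 < β + 1)).hasSum.mul_left
      (betaFn α (β + 1) ^ 2))).tendsto_sum_nat
  simp_rw [hyperMate_succ_sub hα hβ, Finset.sum_range_sub] at h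
  refine tendsto_nhds_unique h ?_
  have h0 : hyperMate α β 0 = 0 := by simp [hyperMate]
  simpa only [h0, sub_zero] using tendsto_hyperMate hα hβ

theorem hyperTerm_nonneg {α β : ℝ} (hα : 1 ≤ α) (hβ : 0 < β) (n : ℕ) : 0 ≤ hyperTerm α β n := by
  have h1 := poch_pos (by linarith : 0 < α) n
  have h2 := poch_pos hβ n
  have h3 := poch_pos (by linarith : 0 < α + β - 1) n
  have h4 := poch_pos (by linarith : 0 < α + β) n
  have h5 := poch_pos one_pos n
  unfold hyperTerm
  positivity

theorem hyperTerm_le {α β : ℝ} (hα : 1 ≤ α) (hβ : 0 < β) (n : ℕ) :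
    hyperTerm α β n ≤ poch α n / poch 1 n := by
  have mono : ∀ {a b : ℝ}, 0 < a → a ≤ b → poch a n ≤ poch b n := fun ha hab =>
    Finset.prod_le_prod (fun i _ => by positivity) (fun i _ => by linarith)
  have h1 := poch_pos (by linarith : 0 < α) n
  have h2 := poch_pos hβ n
  have h3 := poch_pos (by linarith : 0 < α + β - 1) n
  have h4 := poch_pos (by linarith : 0 < α + β) n
  have h5 := poch_pos one_pos n
  have e : hyperTerm α β n = poch α n / poch 1 n * (poch β n / poch (α + β) n) *
      (poch (α + β - 1) n / poch (α + β) n) := by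
    unfold hyperTerm
    field_simp
  rw [e]
  refine mul_le_of_le_one_right (by positivity) ?_ |>.trans
    (mul_le_of_le_one_right (by positivity) ?_)
  · exact (div_le_one h4).2 (mono (by linarith) (by linarith))
  · exact (div_le_one h4).2 (mono hβ (by linarith))

theorem betaFn_sq_mul_hyperTerm_add_one_le {α β : ℝ} (hα : 1 ≤ α) (hβ : 0 < β) (n : ℕ) :
    betaFn α (β + 1) ^ 2 * hyperTerm α (β + 1) n ≤ betaFn α β ^ 2 * hyperTerm α β n := by
  have hα' : 0 < α := by linarith
  have hd : 0 < α + β - 1 + n := by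
    have := n.cast_nonneg (α := ℝ)
    linarith
  have hs : 0 < α + β - 1 := by linarith
  have hq := gaussTerm_pos hα' hβ n
  have e : hyperTerm α β n = gaussTerm α β n * ((α + β - 1) / (α + β - 1 + n)) := by
    rw [mul_div_assoc', eq_div_iff hd.ne', hyperTerm_mul hα' hβ]
  rw [hyperTerm_add_one hα' hβ, betaFn_add_one hα' hβ, e, mul_pow, mul_assoc,
    mul_left_comm _ (gaussTerm α β n)]
  refine mul_le_mul_of_nonneg_left (mul_le_mul_of_nonneg_left ?_ hq.le) (sq_nonneg _)
  have e2 : (β / (α + β)) ^ 2 * ((α + β) ^ 2 * (β + n) / (β * (α + β + n) ^ 2)) =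
      β * (β + n) / (α + β + n) ^ 2 := by
    field_simp
  rw [e2, div_le_div_iff₀ (by positivity) hd]
  have hn := n.cast_nonneg (α := ℝ)
  calc β * (β + n) * (α + β - 1 + n)
      ≤ (α + β - 1) * (α + β + n) * (α + β + n) := by gcongr <;> linarith
    _ = _ := by ring

theorem tendsto_hyperValue_add_nat {α β : ℝ} (hα : 1 ≤ α) (hβ : 0 < β) :
    Tendsto (fun N : ℕ => hyperValue α (β + N)) atTop (𝓝 0) := by
  have hα' : 0 < α := by linarith
  have hpos : ∀ N : ℕ, 0 < β + N := fun N => by positivity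
  simp_rw [hyperValue, ← tsum_mul_left]
  have hanti : ∀ n N : ℕ, betaFn α (β + N) ^ 2 * hyperTerm α (β + N) n ≤
      betaFn α β ^ 2 * hyperTerm α β n := by
    intro n N
    induction N with
    | zero => simp
    | succ N ih =>
      push_cast
      rw [← add_assoc]
      exact (betaFn_sq_mul_hyperTerm_add_one_le hα (hpos N) n).trans ih
  have hnn : ∀ n N : ℕ, 0 ≤ betaFn α (β + N) ^ 2 * hyperTerm α (β + N) n := fun n N =>
    mul_nonneg (sq_nonneg _) (hyperTerm_nonneg hα (hpos N) n)
  have key := tendsto_tsum_of_dominated_convergence (𝓕 := atTop)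
    (f := fun (N n : ℕ) => betaFn α (β + N) ^ 2 * hyperTerm α (β + N) n) (g := fun _ => 0)
    ((summable_hyperTerm hα' hβ).mul_left (betaFn α β ^ 2)) (fun n => ?_)
    (Eventually.of_forall fun N n => ?_)
  · simpa using key
  · have h0 := ((tendsto_betaFn_add_nat hα' hβ).pow 2).mul_const (poch α n / poch 1 n)
    rw [zero_pow two_ne_zero, zero_mul] at h0
    exact squeeze_zero (hnn n)
      (fun N => mul_le_mul_of_nonneg_left (hyperTerm_le hα (hpos N) n) (sq_nonneg _)) h0
  · rw [Real.norm_of_nonneg (hnn n N)]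
    exact hanti n N

theorem hasSum_betaFn_of_one_le {α β : ℝ} (hα : 1 ≤ α) (hβ : 0 < β) :
    HasSum (fun n : ℕ => betaFn α (β + n) / (β + n)) (hyperValue α β) := by
  have hα' : 0 < α := by linarith
  have hpos : ∀ N : ℕ, 0 < β + N := fun N => by positivity
  rw [hasSum_iff_tendsto_nat_of_nonneg
    fun n => (div_pos (betaFn_pos hα' (hpos n)) (hpos n)).le]
  have e : ∀ N : ℕ, ∑ n ∈ Finset.range N, betaFn α (β + n) / (β + n) =
      hyperValue α β - hyperValue α (β + N) := by
    intro N
    induction N with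
    | zero => simp
    | succ N ih =>
      rw [Finset.sum_range_succ, ih, ← hyperValue_sub hα' (hpos N)]
      push_cast
      rw [← add_assoc]
      ring
  simp_rw [e]
  simpa using (tendsto_hyperValue_add_nat hα hβ).const_sub (hyperValue α β)

/-- The terms of the double series defining `Ftilde`. -/
noncomputable def doubleTerm (α β : ℝ) (p : ℕ × ℕ) : ℝ :=
  Real.Gamma α * Real.Gamma β / Real.Gamma (α + β + 1) *
    (poch α p.1 * poch β p.2 / poch (α + β + 1) (p.1 + p.2))

theorem doubleTerm_swap (α β : ℝ) (p : ℕ × ℕ) : doubleTerm α β p.swap = doubleTerm β α p := by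
  simp only [doubleTerm, Prod.fst_swap, Prod.snd_swap, add_comm α β, add_comm p.2,
    mul_comm (Real.Gamma α), mul_comm (poch α p.2)]

theorem hasSum_doubleTerm_swap {α β x : ℝ} :
    HasSum (doubleTerm α β ∘ Prod.swap) x ↔ HasSum (doubleTerm α β) x :=
  (Equiv.prodComm ℕ ℕ).hasSum_iff

theorem hasSum_doubleTerm_left {α β : ℝ} (hα : 0 < α) (hβ : 0 < β) (n : ℕ) :
    HasSum (fun m => doubleTerm α β (m, n)) (betaFn α (β + n) / (β + n)) := by
  have hs : 0 < α + β := add_pos hα hβ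
  have h := (hasSum_poch_div hα (by have := n.cast_nonneg (α := ℝ); linarith :
    α < α + β + n)).mul_left
      (Real.Gamma α * Real.Gamma β / Real.Gamma (α + β + 1) *
        (poch β n / poch (α + β + 1) n))
  have hval : betaFn α (β + n) / (β + n) =
      Real.Gamma α * Real.Gamma β / Real.Gamma (α + β + 1) * (poch β n / poch (α + β + 1) n) *
        ((α + β + n) / (α + β + n - α)) := by
    have h1 := (poch_pos hs n).ne'
    have h4 : poch (α + β + 1) n = poch (α + β) n * (α + β + n) / (α + β) := by
      rw [← mul_poch_add_one]
      field_simp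
    have h5 : α + β + n ≠ 0 := by positivity
    have h6 : β + n ≠ 0 := by positivity
    have h7 := (Real.Gamma_pos_of_pos hs).ne'
    rw [betaFn_add_nat hα hβ, h4, betaFn, Real.Gamma_add_one hs.ne',
      show α + β + (n : ℝ) - α = β + n by ring]
    field_simp
  rw [hval]
  refine h.congr_fun fun m => ?_
  simp only [doubleTerm]
  rw [add_comm m n, poch_add, show α + β + 1 + (n : ℝ) = α + β + n + 1 by ring]
  have h1 := (poch_pos (by positivity : 0 < α + β + 1) n).ne'
  have h2 := (poch_pos (by positivity : 0 < α + β + n + 1) m).ne'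
  field_simp

theorem hasSum_doubleTerm_iff {α β x : ℝ} (hα : 0 < α) (hβ : 0 < β) :
    HasSum (doubleTerm α β) x ↔ HasSum (fun n : ℕ => betaFn α (β + n) / (β + n)) x := by
  have hnn : 0 ≤ doubleTerm α β ∘ Prod.swap := fun p => by
    have h1 := poch_pos hα p.2
    have h2 := poch_pos hβ p.1
    have h3 := poch_pos (by positivity : 0 < α + β + 1) (p.2 + p.1)
    have h4 := Real.Gamma_pos_of_pos hα
    have h5 := Real.Gamma_pos_of_pos hβ
    have h6 := Real.Gamma_pos_of_pos (by positivity : 0 < α + β + 1)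
    simp only [Pi.zero_apply, Function.comp_apply, doubleTerm, Prod.fst_swap, Prod.snd_swap]
    positivity
  have hrow := hasSum_doubleTerm_left hα hβ
  rw [← hasSum_doubleTerm_swap]
  refine ⟨fun h => h.prod_fiberwise hrow, fun h => ?_⟩
  have hsum : Summable (doubleTerm α β ∘ Prod.swap) := by
    rw [summable_prod_of_nonneg hnn]
    exact ⟨fun n => (hrow n).summable, h.summable.congr fun n => (hrow n).tsum_eq.symm⟩
  rw [h.unique (hsum.hasSum.prod_fiberwise hrow)]
  exact hsum.hasSum

theorem hasSum_doubleTerm {α β : ℝ} (hα : 0 < α) (hβ : 0 < β) :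
    HasSum (doubleTerm α β) (hyperValue α β) := by
  have hβ' : 0 < β + 1 := by linarith
  have h1 : HasSum (doubleTerm (β + 1) α) (hyperValue (β + 1) α) :=
    (hasSum_doubleTerm_iff hβ' hα).2 (hasSum_betaFn_of_one_le (by linarith) hα)
  rw [← hasSum_doubleTerm_swap, hyperValue_comm] at h1
  have h2 : HasSum (doubleTerm α (β + 1)) (hyperValue α (β + 1)) :=
    h1.congr_fun fun p => (doubleTerm_swap _ _ p).symm
  rw [hasSum_doubleTerm_iff hα hβ'] at h2
  rw [hasSum_doubleTerm_iff hα hβ, ← hasSum_nat_add_iff' 1]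
  have e : hyperValue α β - ∑ n ∈ Finset.range 1, betaFn α (β + n) / (β + n) =
      hyperValue α (β + 1) := by
    rw [Finset.sum_range_one, Nat.cast_zero, add_zero, ← hyperValue_sub hα hβ]
    ring
  rw [e]
  refine h2.congr_fun fun n => ?_
  push_cast
  rw [add_comm (n : ℝ) 1, add_assoc]

theorem stmt7 (α β : ℝ) (hα : 0 < α) (hβ : 0 < β) :
    Summable (fun n : ℕ =>
      poch α n * poch β n * poch (α + β - 1) n /
        (poch (α + β) n * poch (α + β) n * poch 1 n)) ∧
    Ftilde α β =
      (Real.Gamma α * Real.Gamma β / Real.Gamma (α + β)) ^ 2 *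
        ∑' n : ℕ,
          poch α n * poch β n * poch (α + β - 1) n /
            (poch (α + β) n * poch (α + β) n * poch 1 n) := by
  refine ⟨summable_hyperTerm hα hβ, ?_⟩
  rw [Ftilde, ← tsum_mul_left]
  exact (hasSum_doubleTerm hα hβ).tsum_eq
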